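/- Let c ≤ a ≤ b < d be positive integers and suppose r is not nice. Then for every positive integer n divisible by c+d+1, ex(n, S_{a,b}, S_{c,d}) = r·n. -/

import Mathlib

open SimpleGraph

/-- The number of subgraphs of `G` isomorphic to `H`. -/
noncomputable def copyCount {α β : Type*} (H : SimpleGraph α) (G : SimpleGraph β) : ℕ :=
  Set.ncard {G' : G.Subgraph | Nonempty (H ≃g G'.coe)}

/-- `G` contains a subgraph isomorphic to `F`. -/
def Contains {α β : Type*} (F : SimpleGraph α) (G : SimpleGraph β) : Prop :=
  ∃ f : F →g G, Function.Injective f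

/-- The generalized Turán number `ex(n, H, F)`: the maximum number of subgraphs
isomorphic to `H` in an `F`-free graph on `n` vertices. -/
noncomputable def exGen {α β : Type*} (n : ℕ) (H : SimpleGraph α) (F : SimpleGraph β) : ℕ :=
  sSup {N | ∃ G : SimpleGraph (Fin n), ¬ Contains F G ∧ N = copyCount H G}

/-- The double star `S_{a,b}`: central edge `0-1`, vertices `2,…,a+1` are leaves
attached to `0`, and vertices `a+2,…,a+b+1` are leaves attached to `1`. -/
def doubleStar (a b : ℕ) : SimpleGraph (Fin (a + b + 2)) :=
  SimpleGraph.fromRel (fun x y =>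
    (x.val = 0 ∧ y.val = 1) ∨ (x.val = 0 ∧ 2 ≤ y.val ∧ y.val < a + 2) ∨
      (x.val = 1 ∧ a + 2 ≤ y.val))

section DoubleStarTuples

variable {V : Type*}

/-- The subgraph of `G` spanned by the edges of the double star with central edge `uv`, leaves `A`
attached to `u` and leaves `B` attached to `v`. -/
def doubleStarSubgraph (G : SimpleGraph V) (u v : V) (A B : Finset V) : G.Subgraph where
  verts := {x | x = u ∨ x = v ∨ x ∈ A ∨ x ∈ B}
  Adj x y := G.Adj x y ∧
    ((x = u ∧ (y = v ∨ y ∈ A)) ∨ (x = v ∧ (y = u ∨ y ∈ B)) ∨ (y = u ∧ x ∈ A) ∨ (y = v ∧ x ∈ B))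
  adj_sub h := h.1
  edge_vert h := by
    rcases h with ⟨_, h⟩
    simp only [Set.mem_ofPred_eq]
    tauto
  symm := ⟨fun x y h => by
    refine ⟨h.1.symm, ?_⟩
    have := h.2
    tauto⟩

theorem doubleStar_adj {a b : ℕ} (x y : Fin (a + b + 2)) :
    (doubleStar a b).Adj x y ↔
      (x.val = 0 ∧ (y.val = 1 ∨ (2 ≤ y.val ∧ y.val < a + 2))) ∨
      (x.val = 1 ∧ (y.val = 0 ∨ a + 2 ≤ y.val)) ∨
      (y.val = 0 ∧ 2 ≤ x.val ∧ x.val < a + 2) ∨ (y.val = 1 ∧ a + 2 ≤ x.val) := by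
  simp only [doubleStar, SimpleGraph.fromRel_adj, ne_eq, Fin.ext_iff]
  omega

theorem toSubgraph_eq_doubleStarSubgraph {G : SimpleGraph V} {a b : ℕ} {u v : V}
    {A B : Finset V} (f : Copy (doubleStar a b) G)
    (hu : f ⟨0, by omega⟩ = u) (hv : f ⟨1, by omega⟩ = v)
    (hA : ∀ y, y ∈ A ↔ ∃ i : Fin (a + b + 2), 2 ≤ i.val ∧ i.val < a + 2 ∧ f i = y)
    (hB : ∀ y, y ∈ B ↔ ∃ i : Fin (a + b + 2), a + 2 ≤ i.val ∧ f i = y) :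
    f.toSubgraph = doubleStarSubgraph G u v A B := by
  have hu' : ∀ i : Fin (a + b + 2), i.val = 0 → f i = u := by
    rintro ⟨i, hi⟩ h
    simp only at h
    subst h
    exact hu
  have hv' : ∀ i : Fin (a + b + 2), i.val = 1 → f i = v := by
    rintro ⟨i, hi⟩ h
    simp only at h
    subst h
    exact hv
  have hadj : ∀ i j, (doubleStar a b).Adj i j → G.Adj (f i) (f j) :=
    fun i j h => f.toHom.map_adj h
  ext x y
  · simp only [Copy.toSubgraph, Subgraph.map_verts, Subgraph.verts_top, Set.image_univ,
      Set.mem_range, doubleStarSubgraph, Set.mem_ofPred_eq, hA, hB]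
    constructor
    · rintro ⟨i, rfl⟩
      rcases (by omega : i.val = 0 ∨ i.val = 1 ∨ (2 ≤ i.val ∧ i.val < a + 2) ∨ a + 2 ≤ i.val)
        with h | h | h | h
      · exact Or.inl (hu' i h)
      · exact Or.inr (Or.inl (hv' i h))
      · exact Or.inr (Or.inr (Or.inl ⟨i, h.1, h.2, rfl⟩))
      · exact Or.inr (Or.inr (Or.inr ⟨i, h, rfl⟩))
    · rintro (rfl | rfl | ⟨i, _, _, rfl⟩ | ⟨i, _, rfl⟩)
      · exact ⟨_, hu⟩
      · exact ⟨_, hv⟩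
      · exact ⟨i, rfl⟩
      · exact ⟨i, rfl⟩
  · simp only [Copy.toSubgraph, Subgraph.map_adj, Relation.Map, Subgraph.top_adj,
      doubleStarSubgraph, hA, hB]
    constructor
    · rintro ⟨i, j, h, rfl, rfl⟩
      refine ⟨hadj i j h, ?_⟩
      rcases (doubleStar_adj i j).1 h with ⟨h1, h2 | h2⟩ | ⟨h1, h2 | h2⟩ | ⟨h1, h2⟩ | ⟨h1, h2⟩
      · exact Or.inl ⟨hu' i h1, Or.inl (hv' j h2)⟩
      · exact Or.inl ⟨hu' i h1, Or.inr ⟨j, h2.1, h2.2, rfl⟩⟩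
      · exact Or.inr (Or.inl ⟨hv' i h1, Or.inl (hu' j h2)⟩)
      · exact Or.inr (Or.inl ⟨hv' i h1, Or.inr ⟨j, h2, rfl⟩⟩)
      · exact Or.inr (Or.inr (Or.inl ⟨hu' j h1, i, h2.1, h2.2, rfl⟩))
      · exact Or.inr (Or.inr (Or.inr ⟨hv' j h1, i, h2, rfl⟩))
    · rintro ⟨-, ⟨hx, hy | ⟨j, h1, h2, hy⟩⟩ | ⟨hx, hy | ⟨j, h1, hy⟩⟩ | ⟨hy, j, h1, h2, hx⟩ |
        ⟨hy, j, h1, hx⟩⟩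
      · exact ⟨_, _, (doubleStar_adj _ _).2 (by simp), hu.trans hx.symm, hv.trans hy.symm⟩
      · exact ⟨_, j, (doubleStar_adj _ _).2 (by simp; omega), hu.trans hx.symm, hy⟩
      · exact ⟨_, _, (doubleStar_adj _ _).2 (by simp), hv.trans hx.symm, hu.trans hy.symm⟩
      · exact ⟨_, j, (doubleStar_adj _ _).2 (by simp; omega), hv.trans hx.symm, hy⟩
      · exact ⟨j, _, (doubleStar_adj _ _).2 (by simp; omega), hx, hu.trans hy.symm⟩
      · exact ⟨j, _, (doubleStar_adj _ _).2 (by simp; omega), hx, hv.trans hy.symm⟩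

theorem exists_doubleStar_copy {G : SimpleGraph V} {a b : ℕ} {u v : V} {A B : Finset V}
    (huv : G.Adj u v) (hA : ∀ y ∈ A, G.Adj u y ∧ y ≠ v) (hB : ∀ y ∈ B, G.Adj v y ∧ y ≠ u)
    (hAB : Disjoint A B) (ha : A.card = a) (hb : B.card = b) :
    ∃ f : Copy (doubleStar a b) G, f ⟨0, by omega⟩ = u ∧ f ⟨1, by omega⟩ = v ∧
      (∀ y, y ∈ A ↔ ∃ i : Fin (a + b + 2), 2 ≤ i.val ∧ i.val < a + 2 ∧ f i = y) ∧
      (∀ y, y ∈ B ↔ ∃ i : Fin (a + b + 2), a + 2 ≤ i.val ∧ f i = y) := by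
  classical
  let eA : A ≃ Fin a := A.equivFinOfCardEq ha
  let eB : B ≃ Fin b := B.equivFinOfCardEq hb
  let g : Fin (a + b + 2) → V := fun i =>
    if i.val = 0 then u else if i.val = 1 then v else
    if h : i.val - 2 < a then (eA.symm ⟨i.val - 2, h⟩ : V) else
    if h' : i.val - (a + 2) < b then (eB.symm ⟨i.val - (a + 2), h'⟩ : V) else u
  have g0 : ∀ i : Fin (a + b + 2), i.val = 0 → g i = u := fun i h => by
    simp only [g]
    rw [if_pos h]
  have g1 : ∀ i : Fin (a + b + 2), i.val = 1 → g i = v := fun i h => by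
    simp only [g]
    rw [if_neg (by omega), if_pos h]
  have gA : ∀ (i : Fin (a + b + 2)) (h1 : 2 ≤ i.val) (h2 : i.val < a + 2),
      g i = eA.symm ⟨i.val - 2, by omega⟩ := fun i h1 h2 => by
    simp only [g]
    rw [if_neg (by omega), if_neg (by omega), dif_pos]
  have gB : ∀ (i : Fin (a + b + 2)) (h1 : a + 2 ≤ i.val),
      g i = eB.symm ⟨i.val - (a + 2), by omega⟩ := fun i h1 => by
    simp only [g]
    rw [if_neg (by omega), if_neg (by omega), dif_neg (by omega), dif_pos]
  have memA : ∀ i : Fin (a + b + 2), 2 ≤ i.val → i.val < a + 2 → g i ∈ A := fun i h1 h2 => by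
    rw [gA i h1 h2]
    exact Subtype.property _
  have memB : ∀ i : Fin (a + b + 2), a + 2 ≤ i.val → g i ∈ B := fun i h1 => by
    rw [gB i h1]
    exact Subtype.property _
  have hcase : ∀ i : Fin (a + b + 2),
      i.val = 0 ∨ i.val = 1 ∨ (2 ≤ i.val ∧ i.val < a + 2) ∨ a + 2 ≤ i.val := fun i => by omega
  have uA : u ∉ A := fun h => (hA u h).1.ne rfl
  have vB : v ∉ B := fun h => (hB v h).1.ne rfl
  have uB : u ∉ B := fun h => (hB u h).2 rfl
  have vA : v ∉ A := fun h => (hA v h).2 rfl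
  have dAB : ∀ y, y ∈ A → y ∉ B := fun y h1 h2 => Finset.disjoint_left.1 hAB h1 h2
  have uv : u ≠ v := huv.ne
  have ginj : Function.Injective g := by
    intro i j hij
    rcases hcase i with hi | hi | hi | hi <;> rcases hcase j with hj | hj | hj | hj
    · exact Fin.ext (by omega)
    · rw [g0 i hi, g1 j hj] at hij; exact absurd hij uv
    · have := memA j hj.1 hj.2; rw [← hij, g0 i hi] at this; exact absurd this uA
    · have := memB j hj; rw [← hij, g0 i hi] at this; exact absurd this uB
    · rw [g1 i hi, g0 j hj] at hij; exact absurd hij.symm uv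
    · exact Fin.ext (by omega)
    · have := memA j hj.1 hj.2; rw [← hij, g1 i hi] at this; exact absurd this vA
    · have := memB j hj; rw [← hij, g1 i hi] at this; exact absurd this vB
    · have := memA i hi.1 hi.2; rw [hij, g0 j hj] at this; exact absurd this uA
    · have := memA i hi.1 hi.2; rw [hij, g1 j hj] at this; exact absurd this vA
    · rw [gA i hi.1 hi.2, gA j hj.1 hj.2] at hij
      have := eA.symm.injective (Subtype.ext hij)
      simp only [Fin.mk.injEq] at this
      exact Fin.ext (by omega)
    · have := memA i hi.1 hi.2; rw [hij] at this; exact absurd (memB j hj) (dAB _ this)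
    · have := memB i hi; rw [hij, g0 j hj] at this; exact absurd this uB
    · have := memB i hi; rw [hij, g1 j hj] at this; exact absurd this vB
    · have := memA j hj.1 hj.2; rw [← hij] at this; exact absurd (memB i hi) (dAB _ this)
    · rw [gB i hi, gB j hj] at hij
      have := eB.symm.injective (Subtype.ext hij)
      simp only [Fin.mk.injEq] at this
      exact Fin.ext (by omega)
  have ghom : ∀ i j, (doubleStar a b).Adj i j → G.Adj (g i) (g j) := by
    intro i j h
    rcases (doubleStar_adj i j).1 h with ⟨h1, h2 | h2⟩ | ⟨h1, h2 | h2⟩ | ⟨h1, h2⟩ | ⟨h1, h2⟩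
    · rw [g0 i h1, g1 j h2]; exact huv
    · rw [g0 i h1]; exact (hA _ (memA j h2.1 h2.2)).1
    · rw [g1 i h1, g0 j h2]; exact huv.symm
    · rw [g1 i h1]; exact (hB _ (memB j h2)).1
    · rw [g0 j h1]; exact (hA _ (memA i h2.1 h2.2)).1.symm
    · rw [g1 j h1]; exact (hB _ (memB i h2)).1.symm
  refine ⟨⟨⟨g, fun {i j} h => ghom i j h⟩, ginj⟩, g0 ⟨0, by omega⟩ rfl, g1 ⟨1, by omega⟩ rfl,
    fun y => ⟨fun hy => ?_, ?_⟩, fun y => ⟨fun hy => ?_, ?_⟩⟩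
  · refine ⟨⟨(eA ⟨y, hy⟩).val + 2, by omega⟩, by simp, by simp, ?_⟩
    refine (gA ⟨(eA ⟨y, hy⟩).val + 2, by omega⟩ (by simp) (by simp)).trans ?_
    simp
  · rintro ⟨i, h1, h2, rfl⟩
    exact memA i h1 h2
  · refine ⟨⟨(eB ⟨y, hy⟩).val + (a + 2), by omega⟩, by simp, ?_⟩
    refine (gB ⟨(eB ⟨y, hy⟩).val + (a + 2), by omega⟩ (by simp)).trans ?_
    simp
  · rintro ⟨i, h1, rfl⟩
    exact memB i h1

theorem doubleStarSubgraph_swap (G : SimpleGraph V) (u v : V) (A B : Finset V) :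
    doubleStarSubgraph G v u B A = doubleStarSubgraph G u v A B := by
  ext x y
  · change (x = v ∨ x = u ∨ x ∈ B ∨ x ∈ A) ↔ (x = u ∨ x = v ∨ x ∈ A ∨ x ∈ B)
    tauto
  · simp only [doubleStarSubgraph]
    refine and_congr_right fun _ => ?_
    tauto

/-- The double stars `S_{a,b}` in `G`, recorded as tuples `(u, v, A, B)`: a central edge `uv`,
`a` leaves `A` at `u` and `b` leaves `B` at `v`. -/
def doubleStarTuples [Fintype V] [DecidableEq V] (G : SimpleGraph V) [DecidableRel G.Adj]
    (a b : ℕ) : Finset (Σ _ : V, Σ _ : V, Σ _ : Finset V, Finset V) :=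
  Finset.univ.sigma fun u => (G.neighborFinset u).sigma fun v =>
    (((G.neighborFinset u).erase v).powersetCard a).sigma fun A =>
      (((G.neighborFinset v).erase u) \ A).powersetCard b

variable [Fintype V] [DecidableEq V] (G : SimpleGraph V) [DecidableRel G.Adj]

theorem mem_doubleStarTuples {a b : ℕ} {u v : V} {A B : Finset V} :
    ⟨u, v, A, B⟩ ∈ doubleStarTuples G a b ↔
      G.Adj u v ∧ (∀ y ∈ A, G.Adj u y ∧ y ≠ v) ∧ (∀ y ∈ B, G.Adj v y ∧ y ≠ u) ∧
        Disjoint A B ∧ A.card = a ∧ B.card = b := by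
  simp only [doubleStarTuples, Finset.mem_sigma, Finset.mem_univ, true_and,
    mem_neighborFinset, Finset.mem_powersetCard, Finset.subset_iff, Finset.mem_erase,
    Finset.mem_sdiff, Finset.disjoint_right]
  grind

theorem isoSubgraphs_eq_image (a b : ℕ) :
    {G' : G.Subgraph | Nonempty (doubleStar a b ≃g G'.coe)} =
      (fun t => doubleStarSubgraph G t.1 t.2.1 t.2.2.1 t.2.2.2) ''
        (doubleStarTuples G a b : Set (Σ _ : V, Σ _ : V, Σ _ : Finset V, Finset V)) := by
  rw [← Copy.range_toSubgraph]
  ext G'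
  simp only [Set.mem_range, Set.mem_image, Finset.mem_coe]
  constructor
  · rintro ⟨f, rfl⟩
    have hadj : ∀ i j, (doubleStar a b).Adj i j → G.Adj (f i) (f j) :=
      fun i j h => f.toHom.map_adj h
    have hinj : ∀ i j, f i = f j → i = j := fun i j h => f.injective h
    let A := (Finset.univ.filter
      (fun i : Fin (a + b + 2) => 2 ≤ i.val ∧ i.val < a + 2)).image f
    let B := (Finset.univ.filter (fun i : Fin (a + b + 2) => a + 2 ≤ i.val)).image f
    refine ⟨⟨f ⟨0, by omega⟩, f ⟨1, by omega⟩, A, B⟩, ?_, ?_⟩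
    · rw [mem_doubleStarTuples]
      refine ⟨hadj _ _ ((doubleStar_adj _ _).2 (by simp)), ?_, ?_, ?_, ?_, ?_⟩
      · intro y hy
        obtain ⟨i, hi, rfl⟩ := Finset.mem_image.1 hy
        simp only [Finset.mem_filter, Finset.mem_univ, true_and] at hi
        refine ⟨hadj _ _ ((doubleStar_adj _ _).2 (by simp; omega)), fun h => ?_⟩
        have := congrArg Fin.val (hinj _ _ h)
        simp only at this
        omega
      · intro y hy
        obtain ⟨i, hi, rfl⟩ := Finset.mem_image.1 hy
        simp only [Finset.mem_filter, Finset.mem_univ, true_and] at hi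
        refine ⟨hadj _ _ ((doubleStar_adj _ _).2 (by simp; omega)), fun h => ?_⟩
        have := congrArg Fin.val (hinj _ _ h)
        simp only at this
        omega
      · refine (Finset.disjoint_image f.injective).2 (Finset.disjoint_filter.2 fun i _ h => ?_)
        omega
      · refine (Finset.card_image_of_injective _ f.injective).trans ?_
        have : (Finset.univ.filter (fun i : Fin (a + b + 2) => 2 ≤ i.val ∧ i.val < a + 2)).map
            Fin.valEmbedding = Finset.Ico 2 (a + 2) := by
          ext x
          simp only [Finset.mem_map, Finset.mem_filter, Finset.mem_univ, true_and,
            Fin.valEmbedding_apply, Finset.mem_Ico]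
          exact ⟨by rintro ⟨i, hi, rfl⟩; exact hi, fun h => ⟨⟨x, by omega⟩, h, rfl⟩⟩
        rw [← Finset.card_map Fin.valEmbedding, this]
        simp
      · refine (Finset.card_image_of_injective _ f.injective).trans ?_
        have : (Finset.univ.filter (fun i : Fin (a + b + 2) => a + 2 ≤ i.val)).map
            Fin.valEmbedding = Finset.Ico (a + 2) (a + b + 2) := by
          ext x
          simp only [Finset.mem_map, Finset.mem_filter, Finset.mem_univ, true_and,
            Fin.valEmbedding_apply, Finset.mem_Ico]
          exact ⟨by rintro ⟨i, hi, rfl⟩; exact ⟨hi, i.2⟩, fun h => ⟨⟨x, h.2⟩, h.1, rfl⟩⟩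
        rw [← Finset.card_map Fin.valEmbedding, this, Nat.card_Ico]
        omega
    · refine (toSubgraph_eq_doubleStarSubgraph f rfl rfl (fun y => ?_) (fun y => ?_)).symm
      · simp [A, and_assoc]
      · simp [B]
  · rintro ⟨⟨u, v, A, B⟩, ht, rfl⟩
    rw [mem_doubleStarTuples] at ht
    obtain ⟨h1, h2, h3, h4, h5, h6⟩ := ht
    obtain ⟨f, hu, hv, hA, hB⟩ := exists_doubleStar_copy h1 h2 h3 h4 h5 h6
    exact ⟨f, toSubgraph_eq_doubleStarSubgraph f hu hv hA hB⟩

theorem doubleStarSubgraph_injective_up_to_swap {a b : ℕ} (ha : 0 < a) (hb : 0 < b)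
    {u v u' v' : V} {A B A' B' : Finset V}
    (h : ⟨u, v, A, B⟩ ∈ doubleStarTuples G a b) (h' : ⟨u', v', A', B'⟩ ∈ doubleStarTuples G a b)
    (heq : doubleStarSubgraph G u v A B = doubleStarSubgraph G u' v' A' B') :
    (u' = u ∧ v' = v ∧ A' = A ∧ B' = B) ∨ (u' = v ∧ v' = u ∧ A' = B ∧ B' = A) := by
  rw [mem_doubleStarTuples] at h h'
  have center : ∀ {u v : V} {A B : Finset V},
      (G.Adj u v ∧ (∀ y ∈ A, G.Adj u y ∧ y ≠ v) ∧ (∀ y ∈ B, G.Adj v y ∧ y ≠ u) ∧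
        Disjoint A B ∧ A.card = a ∧ B.card = b) → ∀ x,
      (x = u ∨ x = v) ↔ ∃ y z, y ≠ z ∧ (doubleStarSubgraph G u v A B).Adj x y ∧
        (doubleStarSubgraph G u v A B).Adj x z := by
    rintro u v A B ⟨h1, h2, h3, h4, h5, h6⟩ x
    obtain ⟨p, hp⟩ := Finset.card_pos.1 (h5 ▸ ha)
    obtain ⟨q, hq⟩ := Finset.card_pos.1 (h6 ▸ hb)
    constructor
    · rintro (rfl | rfl)
      · exact ⟨v, p, (h2 p hp).2.symm, ⟨h1, by simp⟩, (h2 p hp).1, by simp [hp]⟩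
      · exact ⟨u, q, (h3 q hq).2.symm, ⟨h1.symm, by simp⟩, (h3 q hq).1, by simp [hq]⟩
    · rintro ⟨y, z, hyz, ⟨_, hy⟩, ⟨_, hz⟩⟩
      rw [Finset.disjoint_left] at h4
      grind
  have left : ∀ {u v : V} {A B : Finset V},
      (G.Adj u v ∧ (∀ y ∈ A, G.Adj u y ∧ y ≠ v) ∧ (∀ y ∈ B, G.Adj v y ∧ y ≠ u) ∧
        Disjoint A B ∧ A.card = a ∧ B.card = b) → ∀ x,
      x ∈ A ↔ x ≠ v ∧ (doubleStarSubgraph G u v A B).Adj u x := by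
    rintro u v A B ⟨h1, h2, h3, h4, h5, h6⟩ x
    have := h1.ne
    simp only [doubleStarSubgraph]
    grind
  have right : ∀ {u v : V} {A B : Finset V},
      (G.Adj u v ∧ (∀ y ∈ A, G.Adj u y ∧ y ≠ v) ∧ (∀ y ∈ B, G.Adj v y ∧ y ≠ u) ∧
        Disjoint A B ∧ A.card = a ∧ B.card = b) → ∀ x,
      x ∈ B ↔ x ≠ u ∧ (doubleStarSubgraph G u v A B).Adj v x := by
    rintro u v A B ⟨h1, h2, h3, h4, h5, h6⟩ x
    have := h1.ne
    simp only [doubleStarSubgraph]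
    grind
  have hc := center h
  have hc' := center h'
  rw [← heq] at hc'
  have hiff : ∀ x, (x = u ∨ x = v) ↔ (x = u' ∨ x = v') := fun x => (hc x).trans (hc' x).symm
  have hne := h.1.ne
  have hne' := h'.1.ne
  have hu := (hiff u').2 (Or.inl rfl)
  have hv := (hiff v').2 (Or.inr rfl)
  have hA := left h
  have hA' := left h'
  have hB := right h
  have hB' := right h'
  rw [← heq] at hA' hB'
  have hpair : (u' = u ∧ v' = v) ∨ (u' = v ∧ v' = u) := by
    clear hA hA' hB hB' hc hc' hiff center left right h h' heq
    grind
  rcases hpair with ⟨rfl, rfl⟩ | ⟨rfl, rfl⟩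
  · exact Or.inl ⟨rfl, rfl, Finset.ext fun x => (hA' x).trans (hA x).symm,
      Finset.ext fun x => (hB' x).trans (hB x).symm⟩
  · exact Or.inr ⟨rfl, rfl, Finset.ext fun x => (hA' x).trans (hB x).symm,
      Finset.ext fun x => (hB' x).trans (hA x).symm⟩

theorem copyCount_doubleStar_of_ne {a b : ℕ} (ha : 0 < a) (hb : 0 < b) (hab : a ≠ b) :
    _root_.copyCount (doubleStar a b) G = (doubleStarTuples G a b).card := by
  rw [_root_.copyCount, isoSubgraphs_eq_image, Set.InjOn.ncard_image, Set.ncard_coe_finset]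
  rintro ⟨u, v, A, B⟩ h ⟨u', v', A', B'⟩ h' heq
  rcases doubleStarSubgraph_injective_up_to_swap G ha hb h h' heq with
    ⟨rfl, rfl, rfl, rfl⟩ | ⟨rfl, rfl, rfl, rfl⟩
  · rfl
  · rw [Finset.mem_coe, mem_doubleStarTuples] at h h'
    exact absurd (h'.2.2.2.2.1.symm.trans h.2.2.2.2.2) hab

theorem two_mul_copyCount_doubleStar_self {a : ℕ} (ha : 0 < a) :
    2 * _root_.copyCount (doubleStar a a) G = (doubleStarTuples G a a).card := by
  classical
  rw [_root_.copyCount, isoSubgraphs_eq_image, ← Finset.coe_image, Set.ncard_coe_finset,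
    mul_comm, ← smul_eq_mul, ← Finset.sum_const]
  rw [Finset.card_eq_sum_card_image
    (fun t => doubleStarSubgraph G t.1 t.2.1 t.2.2.1 t.2.2.2) (doubleStarTuples G a a)]
  refine Finset.sum_congr rfl fun S hS => ?_
  obtain ⟨⟨u, v, A, B⟩, ht, rfl⟩ := Finset.mem_image.1 hS
  have ht' := (mem_doubleStarTuples G).1 ht
  have hswap : (⟨v, u, B, A⟩ : Σ _ : V, Σ _ : V, Σ _ : Finset V, Finset V) ∈
      doubleStarTuples G a a := by
    rw [mem_doubleStarTuples]
    exact ⟨ht'.1.symm, ht'.2.2.1, ht'.2.1, ht'.2.2.2.1.symm, ht'.2.2.2.2.2, ht'.2.2.2.2.1⟩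
  symm
  rw [Finset.card_eq_two]
  refine ⟨⟨u, v, A, B⟩, ⟨v, u, B, A⟩, fun h => ht'.1.ne (congrArg Sigma.fst h), ?_⟩
  ext ⟨u', v', A', B'⟩
  simp only [Finset.mem_filter, Finset.mem_insert, Finset.mem_singleton]
  constructor
  · rintro ⟨h', heq⟩
    rcases doubleStarSubgraph_injective_up_to_swap G ha ha ht h' heq.symm with
      ⟨rfl, rfl, rfl, rfl⟩ | ⟨rfl, rfl, rfl, rfl⟩
    · exact Or.inl rfl
    · exact Or.inr rfl
  · rintro (h | h)
    · cases h
      exact ⟨ht, rfl⟩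
    · cases h
      exact ⟨hswap, doubleStarSubgraph_swap G u v A B⟩

/-- The number of double stars `S_{a,b}` with ordered central edge `(u, v)`. -/
def doubleStarsAt (a b : ℕ) (u v : V) : ℕ :=
  ∑ A ∈ ((G.neighborFinset u).erase v).powersetCard a,
    (((G.neighborFinset v).erase u) \ A).card.choose b

theorem card_doubleStarTuples (a b : ℕ) :
    (doubleStarTuples G a b).card = ∑ u, ∑ v ∈ G.neighborFinset u, doubleStarsAt G a b u v := by
  simp only [doubleStarTuples, Finset.card_sigma, Finset.card_powersetCard, doubleStarsAt]

theorem doubleStarsAt_le_of_degree_le {a b d : ℕ} {u v : V} (huv : G.Adj u v)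
    (hu : G.degree u ≤ d) (hv : G.degree v ≤ d) :
    doubleStarsAt G a b u v ≤ (d - 1).choose a * (d - 1).choose b := by
  have hcu : ((G.neighborFinset u).erase v).card ≤ d - 1 := by
    rw [Finset.card_erase_of_mem (by simpa using huv), card_neighborFinset_eq_degree]
    omega
  have hcv : ((G.neighborFinset v).erase u).card ≤ d - 1 := by
    rw [Finset.card_erase_of_mem (by simpa using huv.symm), card_neighborFinset_eq_degree]
    omega
  calc doubleStarsAt G a b u v
      ≤ ∑ A ∈ ((G.neighborFinset u).erase v).powersetCard a, (d - 1).choose b :=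
        Finset.sum_le_sum fun A _ => Nat.choose_le_choose b
          ((Finset.card_le_card Finset.sdiff_subset).trans hcv)
    _ = ((G.neighborFinset u).erase v).card.choose a * (d - 1).choose b := by
        rw [Finset.sum_const, Finset.card_powersetCard, smul_eq_mul]
    _ ≤ _ := Nat.mul_le_mul_right _ (Nat.choose_le_choose a hcu)

theorem doubleStarsAt_le_of_card_union_le {a b m : ℕ} {u v : V}
    (h : ((G.neighborFinset u).erase v ∪ (G.neighborFinset v).erase u).card ≤ m) :
    doubleStarsAt G a b u v ≤ m.choose a * (m - a).choose b := by
  calc doubleStarsAt G a b u v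
      ≤ ∑ A ∈ ((G.neighborFinset u).erase v).powersetCard a, (m - a).choose b := by
        refine Finset.sum_le_sum fun A hA => Nat.choose_le_choose b ?_
        rw [Finset.mem_powersetCard] at hA
        have hsub : ((G.neighborFinset v).erase u) \ A ⊆
            ((G.neighborFinset u).erase v ∪ (G.neighborFinset v).erase u) \ A :=
          Finset.sdiff_subset_sdiff Finset.subset_union_right subset_rfl
        have := Finset.card_le_card hsub
        rw [Finset.card_sdiff_of_subset (hA.1.trans Finset.subset_union_left)] at this
        omega
    _ = ((G.neighborFinset u).erase v).card.choose a * (m - a).choose b := by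
        rw [Finset.sum_const, Finset.card_powersetCard, smul_eq_mul]
    _ ≤ _ := Nat.mul_le_mul_right _ (Nat.choose_le_choose a
        ((Finset.card_le_card Finset.subset_union_left).trans h))

theorem le_card_of_doubleStarsAt_ne_zero {a b : ℕ} {u v : V}
    (h : doubleStarsAt G a b u v ≠ 0) :
    a ≤ ((G.neighborFinset u).erase v).card ∧ b ≤ ((G.neighborFinset v).erase u).card := by
  obtain ⟨A, hA, hne⟩ := Finset.exists_ne_zero_of_sum_ne_zero h
  rw [Finset.mem_powersetCard] at hA
  refine ⟨hA.2 ▸ Finset.card_le_card hA.1, ?_⟩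
  by_contra! hlt
  exact hne (Nat.choose_eq_zero_of_lt
    ((Finset.card_le_card Finset.sdiff_subset).trans_lt hlt))

variable {G}

theorem card_union_lt_of_not_contains {c d : ℕ} (hG : ¬ Contains (doubleStar c d) G) {u v : V}
    (huv : G.Adj u v) (hu : d ≤ ((G.neighborFinset u).erase v).card)
    (hv : c ≤ ((G.neighborFinset v).erase u).card) :
    ((G.neighborFinset u).erase v ∪ (G.neighborFinset v).erase u).card < c + d := by
  by_contra! hm
  set P := (G.neighborFinset u).erase v with hP
  set Q := (G.neighborFinset v).erase u with hQ
  obtain ⟨Y, hYQ, hYc, hYd⟩ : ∃ Y ⊆ Q, Y.card = c ∧ d ≤ (P \ Y).card := by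
    rcases le_total c (Q \ P).card with h | h
    · obtain ⟨Y, hY, hYc⟩ := Finset.exists_subset_card_eq h
      refine ⟨Y, hY.trans Finset.sdiff_subset, hYc, ?_⟩
      rwa [Finset.sdiff_eq_self_of_disjoint]
      exact (Finset.disjoint_of_subset_left hY Finset.sdiff_disjoint).symm
    · obtain ⟨Y, hY1, hY2, hYc⟩ := Finset.exists_subsuperset_card_eq Finset.sdiff_subset h hv
      refine ⟨Y, hY2, hYc, ?_⟩
      have hsub : (P ∪ Q) \ Y ⊆ P \ Y := by
        intro x hx
        have := @hY1 x
        simp only [Finset.mem_sdiff, Finset.mem_union] at hx this ⊢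
        tauto
      have h1 := Finset.card_le_card hsub
      have h2 := Finset.le_card_sdiff Y (P ∪ Q)
      omega
  obtain ⟨X, hX, hXd⟩ := Finset.exists_subset_card_eq hYd
  have hXP : ∀ y ∈ X, y ∈ P ∧ y ∉ Y := fun y hy => Finset.mem_sdiff.1 (hX hy)
  obtain ⟨f, -⟩ := exists_doubleStar_copy (a := c) (b := d) (A := Y) (B := X) huv.symm
    (fun y hy => by simpa [hQ, and_comm] using hYQ hy)
    (fun y hy => by simpa [hP, and_comm] using (hXP y hy).1)
    (Finset.disjoint_right.2 fun y hy => (hXP y hy).2) hYc hXd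
  exact hG ⟨f.toHom, f.injective⟩

theorem sum_doubleStarsAt_le {a b c d : ℕ} (hd : 0 < d) (hca : c ≤ a) (hab : a ≤ b)
    (hG : ¬ Contains (doubleStar c d) G) (u : V) :
    ∑ v ∈ G.neighborFinset u, doubleStarsAt G a b u v ≤
      max ((c + d) * ((c + d - 1).choose a * (c + d - 1 - a).choose b))
        (d * ((d - 1).choose a * (d - 1).choose b)) := by
  set M := (c + d - 1).choose a * (c + d - 1 - a).choose b
  set M' := (d - 1).choose a * (d - 1).choose b
  have herase : ∀ {x y : V}, G.Adj x y →
      ((G.neighborFinset x).erase y).card = G.degree x - 1 := fun {x y} h => by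
    rw [Finset.card_erase_of_mem (by simpa using h), card_neighborFinset_eq_degree]
  have hunion : ∀ v, G.Adj u v → (d < G.degree u ∨ d < G.degree v) →
      doubleStarsAt G a b u v ≠ 0 →
      ((G.neighborFinset u).erase v ∪ (G.neighborFinset v).erase u).card ≤ c + d - 1 := by
    intro v huv hdeg hne
    obtain ⟨h1, h2⟩ := le_card_of_doubleStarsAt_ne_zero G hne
    have e1 := herase huv
    have e2 := herase huv.symm
    rcases hdeg with h | h
    · have := card_union_lt_of_not_contains hG huv (by omega) (by omega)
      omega
    · have := card_union_lt_of_not_contains hG huv.symm (by omega) (by omega)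
      rw [Finset.union_comm] at this
      omega
  have hM : ∀ v, G.Adj u v → (d < G.degree u ∨ d < G.degree v) →
      doubleStarsAt G a b u v ≤ M := by
    intro v huv hdeg
    by_cases h0 : doubleStarsAt G a b u v = 0
    · omega
    · exact doubleStarsAt_le_of_card_union_le G (hunion v huv hdeg h0)
  rcases le_or_gt (G.degree u) d with hu | hu
  · have hle : ∀ v ∈ G.neighborFinset u, doubleStarsAt G a b u v ≤ max M M' := by
      intro v hv
      rw [mem_neighborFinset] at hv
      rcases le_or_gt (G.degree v) d with hvd | hvd
      · exact (doubleStarsAt_le_of_degree_le G hv hu hvd).trans (le_max_right _ _)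
      · exact (hM v hv (Or.inr hvd)).trans (le_max_left _ _)
    calc ∑ v ∈ G.neighborFinset u, doubleStarsAt G a b u v
        ≤ (G.neighborFinset u).card • max M M' := Finset.sum_le_card_nsmul _ _ _ hle
      _ ≤ d * max M M' := by
          rw [smul_eq_mul, card_neighborFinset_eq_degree]
          exact Nat.mul_le_mul_right _ hu
      _ = max (d * M) (d * M') := Nat.mul_max_mul_left _ _ _ |>.symm
      _ ≤ _ := max_le_max (Nat.mul_le_mul_right _ (by omega)) le_rfl
  · refine le_trans ?_ (le_max_left _ _)
    by_cases h0 : ∀ v ∈ G.neighborFinset u, doubleStarsAt G a b u v = 0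
    · rw [Finset.sum_eq_zero h0]
      exact Nat.zero_le _
    push Not at h0
    obtain ⟨w, hw, hne⟩ := h0
    rw [mem_neighborFinset] at hw
    have hdeg : G.degree u ≤ c + d := by
      have h1 := hunion w hw (Or.inl hu) hne
      have h2 := Finset.card_le_card (Finset.subset_union_left
        (s₁ := (G.neighborFinset u).erase w) (s₂ := (G.neighborFinset w).erase u))
      rw [herase hw] at h2
      omega
    calc ∑ v ∈ G.neighborFinset u, doubleStarsAt G a b u v
        ≤ (G.neighborFinset u).card • M := Finset.sum_le_card_nsmul _ _ _ fun v hv =>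
          hM v (by simpa using hv) (Or.inl hu)
      _ ≤ (c + d) * M := by
          rw [smul_eq_mul, card_neighborFinset_eq_degree]
          exact Nat.mul_le_mul_right _ hdeg

theorem card_doubleStarTuples_le {a b c d : ℕ} (hd : 0 < d) (hca : c ≤ a) (hab : a ≤ b)
    (hG : ¬ Contains (doubleStar c d) G) :
    (doubleStarTuples G a b).card ≤ Fintype.card V *
      max ((c + d) * ((c + d - 1).choose a * (c + d - 1 - a).choose b))
        (d * ((d - 1).choose a * (d - 1).choose b)) := by
  rw [card_doubleStarTuples, ← smul_eq_mul]
  exact Finset.sum_le_card_nsmul _ _ _ fun u _ => sum_doubleStarsAt_le hd hca hab hG u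

end DoubleStarTuples

/-- The disjoint union of the complete graphs on the fibres of `g`. -/
def fiberCliques {V ι : Type*} (g : V → ι) : SimpleGraph V where
  Adj x y := x ≠ y ∧ g x = g y
  symm := ⟨fun _ _ h => ⟨h.1.symm, h.2.symm⟩⟩
  loopless := ⟨fun _ h => h.1 rfl⟩

section FiberCliques

variable {V ι : Type*} [Fintype V] [DecidableEq ι] {g : V → ι}

theorem not_contains_doubleStar_fiberCliques {c d : ℕ}
    (hg : ∀ u, (Finset.univ.filter fun y => g y = g u).card = c + d + 1) :
    ¬ Contains (doubleStar c d) (fiberCliques g) := by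
  rintro ⟨f, hf⟩
  have hadj : ∀ i j, (doubleStar c d).Adj i j → g (f i) = g (f j) := fun i j h => (f.map_adj h).2
  have h01 : g (f ⟨0, by omega⟩) = g (f ⟨1, by omega⟩) :=
    hadj _ _ ((doubleStar_adj _ _).2 (by simp))
  have hall : ∀ i, g (f i) = g (f ⟨0, by omega⟩) := by
    intro i
    rcases (by omega : i.val = 0 ∨ i.val = 1 ∨ (2 ≤ i.val ∧ i.val < c + 2) ∨ c + 2 ≤ i.val)
      with h | h | h | h
    · exact congrArg (fun j => g (f j)) (Fin.ext h)
    · exact hadj _ _ ((doubleStar_adj _ _).2 (by simp; omega))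
    · exact hadj _ _ ((doubleStar_adj _ _).2 (by simp; omega))
    · exact (hadj _ _ ((doubleStar_adj _ _).2 (by simp; omega))).trans h01.symm
  have hsub : Finset.univ.map ⟨f, hf⟩ ⊆
      Finset.univ.filter fun y => g y = g (f ⟨0, by omega⟩) := by
    intro y hy
    obtain ⟨i, _, rfl⟩ := Finset.mem_map.1 hy
    exact Finset.mem_filter.2 ⟨Finset.mem_univ _, hall i⟩
  have := Finset.card_le_card hsub
  rw [Finset.card_map, hg, Finset.card_univ, Fintype.card_fin] at this
  omega

theorem card_doubleStarTuples_fiberCliques [DecidableEq V] [DecidableRel (fiberCliques g).Adj]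
    {s : ℕ}
    (hg : ∀ u, (Finset.univ.filter fun y => g y = g u).card = s + 1) (a b : ℕ) :
    (doubleStarTuples (fiberCliques g) a b).card = Fintype.card V *
      (s * ((s - 1).choose a * (s - 1 - a).choose b)) := by
  have hnb : ∀ u, (fiberCliques g).neighborFinset u =
      (Finset.univ.filter fun y => g y = g u).erase u := by
    intro u
    ext y
    rw [mem_neighborFinset]
    simp only [fiberCliques, Finset.mem_erase, Finset.mem_filter, Finset.mem_univ, true_and]
    exact ⟨fun h => ⟨h.1.symm, h.2.symm⟩, fun h => ⟨h.1.symm, h.2.symm⟩⟩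
  have hdeg : ∀ u, ((fiberCliques g).neighborFinset u).card = s := by
    intro u
    rw [hnb, Finset.card_erase_of_mem (by simp), hg]
    rfl
  have hat : ∀ u v, (fiberCliques g).Adj u v →
      doubleStarsAt (fiberCliques g) a b u v = (s - 1).choose a * (s - 1 - a).choose b := by
    intro u v huv
    have hcard : (((fiberCliques g).neighborFinset u).erase v).card = s - 1 := by
      rw [Finset.card_erase_of_mem (by simpa using huv), hdeg]
    have hsymm : ((fiberCliques g).neighborFinset v).erase u =
        ((fiberCliques g).neighborFinset u).erase v := by
      rw [hnb, hnb, Finset.erase_right_comm, huv.2]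
    rw [doubleStarsAt, hsymm]
    have : ∀ A ∈ (((fiberCliques g).neighborFinset u).erase v).powersetCard a,
        ((((fiberCliques g).neighborFinset u).erase v) \ A).card.choose b =
          (s - 1 - a).choose b := by
      intro A hA
      rw [Finset.mem_powersetCard] at hA
      rw [Finset.card_sdiff_of_subset hA.1, hcard, hA.2]
    rw [Finset.sum_congr rfl this, Finset.sum_const, Finset.card_powersetCard, hcard, smul_eq_mul]
  rw [card_doubleStarTuples]
  have hrow : ∀ u, ∑ v ∈ (fiberCliques g).neighborFinset u,
      doubleStarsAt (fiberCliques g) a b u v = s * ((s - 1).choose a * (s - 1 - a).choose b) := by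
    intro u
    rw [Finset.sum_congr rfl fun v hv => hat u v (by simpa using hv), Finset.sum_const, hdeg,
      smul_eq_mul]
  rw [Finset.sum_congr rfl fun u _ => hrow u, Finset.sum_const, smul_eq_mul, Finset.card_univ]

end FiberCliques

theorem exists_fiber_card_eq (k s : ℕ) :
    ∃ g : Fin (k * s) → Fin k, ∀ u, (Finset.univ.filter fun y => g y = g u).card = s := by
  refine ⟨fun x => (finProdFinEquiv.symm x).1, fun u => ?_⟩
  let row : Fin s → Fin (k * s) := fun j => finProdFinEquiv ((finProdFinEquiv.symm u).1, j)
  have hrow : Function.Injective row := fun i j h =>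
    congrArg Prod.snd (finProdFinEquiv.injective h)
  have himage : (Finset.univ.filter fun y : Fin (k * s) =>
      (finProdFinEquiv.symm y).1 = (finProdFinEquiv.symm u).1) = Finset.univ.image row := by
    ext y
    rw [Finset.mem_filter, Finset.mem_image]
    constructor
    · rintro ⟨-, h⟩
      refine ⟨(finProdFinEquiv.symm y).2, Finset.mem_univ _, ?_⟩
      have hy : finProdFinEquiv.symm y =
          ((finProdFinEquiv.symm u).1, (finProdFinEquiv.symm y).2) := Prod.ext h rfl
      exact ((Equiv.symm_apply_eq _).1 hy).symm
    · rintro ⟨j, -, rfl⟩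
      have hj : finProdFinEquiv.symm (row j) = ((finProdFinEquiv.symm u).1, j) :=
        Equiv.symm_apply_apply _ _
      exact ⟨Finset.mem_univ _, (congrArg Prod.fst hj :)⟩
  rw [himage, Finset.card_image_of_injective _ hrow, Finset.card_univ, Fintype.card_fin]

theorem exGen_doubleStar_eq {a b c d n : ℕ} (ha : 0 < a) (hd : 0 < d) (hca : c ≤ a) (hab : a ≤ b)
    (hlt : d * ((d - 1).choose a * (d - 1).choose b) ≤
      (c + d) * ((c + d - 1).choose a * (c + d - 1 - a).choose b))
    (hn : (c + d + 1) ∣ n) :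
    (if a = b then 2 else 1) * exGen n (doubleStar a b) (doubleStar c d) =
      n * ((c + d) * ((c + d - 1).choose a * (c + d - 1 - a).choose b)) := by
  classical
  have hb : 0 < b := by omega
  have hcount : ∀ G : SimpleGraph (Fin n),
      (if a = b then 2 else 1) * _root_.copyCount (doubleStar a b) G =
        (doubleStarTuples G a b).card := by
    intro G
    split_ifs with h
    · subst h
      exact two_mul_copyCount_doubleStar_self G ha
    · rw [one_mul, copyCount_doubleStar_of_ne G ha hb h]
  obtain ⟨G₀, hfree, hcard⟩ : ∃ G : SimpleGraph (Fin n), ¬ Contains (doubleStar c d) G ∧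
      (doubleStarTuples G a b).card =
        n * ((c + d) * ((c + d - 1).choose a * (c + d - 1 - a).choose b)) := by
    obtain ⟨k, rfl⟩ := hn
    rw [mul_comm (c + d + 1) k]
    obtain ⟨g, hg⟩ := exists_fiber_card_eq k (c + d + 1)
    refine ⟨fiberCliques g, not_contains_doubleStar_fiberCliques hg, ?_⟩
    rw [card_doubleStarTuples_fiberCliques hg, Fintype.card_fin]
  have hgreatest : IsGreatest {N | ∃ G : SimpleGraph (Fin n), ¬ Contains (doubleStar c d) G ∧
      N = _root_.copyCount (doubleStar a b) G} (_root_.copyCount (doubleStar a b) G₀) := by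
    refine ⟨⟨G₀, hfree, rfl⟩, ?_⟩
    rintro N ⟨G, hG, rfl⟩
    have hle := card_doubleStarTuples_le hd hca hab hG
    rw [max_eq_left hlt, Fintype.card_fin, ← hcard, ← hcount G, ← hcount G₀] at hle
    exact Nat.le_of_mul_le_mul_left hle (by split_ifs <;> omega)
  rw [exGen, hgreatest.csSup_eq, hcount, hcard]

/-- if `r` is not nice, then for every `n` divisible by `c+d+1`,
`ex(n, S_{a,b}, S_{c,d}) = r·n`. -/
theorem exGen_doubleStar_doubleStar_not_nice (a b c d : ℕ) (hc : 0 < c)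
    (hca : c ≤ a) (hab : a ≤ b) (hbd : b < d) (r : ℝ)
    (hr : r = if a = b
      then max ((((c : ℝ) + d) / 2) * ((c + d - 1).choose a) * ((c + d - 1 - a).choose b))
               (((d : ℝ) / 2) * ((d - 1).choose a) * ((d - 1).choose b))
      else max (((c : ℝ) + d) * ((c + d - 1).choose a) * ((c + d - 1 - a).choose b))
               ((d : ℝ) * ((d - 1).choose a) * ((d - 1).choose b)))
    (hnotnice : r ≠ (if a = b then (d : ℝ) / 2 else (d : ℝ)) *
      ((d - 1).choose a) * ((d - 1).choose b)) :
    ∀ n : ℕ, 0 < n → (c + d + 1) ∣ n →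
      (exGen n (doubleStar a b) (doubleStar c d) : ℝ) = r * n := by
  intro n _ hdvd
  have key := fun hlt => exGen_doubleStar_eq (n := n) (hc.trans_le hca) (by omega) hca hab hlt hdvd
  by_cases h : a = b
  · simp only [if_pos h] at hr hnotnice key
    have hlt := lt_of_not_ge fun hge => hnotnice (hr.trans (max_eq_right hge))
    rw [max_eq_left hlt.le] at hr
    have hk := key (by
      have h2 : (d : ℝ) * (((d - 1).choose a) * ((d - 1).choose b)) ≤
          ((c : ℝ) + d) * (((c + d - 1).choose a) * ((c + d - 1 - a).choose b)) := by linarith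
      exact_mod_cast h2)
    have hk' := congrArg (Nat.cast (R := ℝ)) hk
    push_cast at hk'
    rw [hr]
    linarith
  · simp only [if_neg h] at hr hnotnice key
    have hlt := lt_of_not_ge fun hge => hnotnice (hr.trans (max_eq_right hge))
    rw [max_eq_left hlt.le] at hr
    have hk := key (by
      have h2 : (d : ℝ) * (((d - 1).choose a) * ((d - 1).choose b)) ≤
          ((c : ℝ) + d) * (((c + d - 1).choose a) * ((c + d - 1 - a).choose b)) := by linarith
      exact_mod_cast h2)
    have hk' := congrArg (Nat.cast (R := ℝ)) hk
    push_cast at hk'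
    rw [hr]
    linarith
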